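/- Let R be a commutative ring, let k ≥ 1, and let c_1, …, c_k : ℤ → R be functions for which there exists an integer B ≥ 0 with c_i(b) = 0 whenever b > B (for every i). Then for every proper subset T ⊊ {1,…,k} the set of tuples (b_1,…,b_k) ∈ ℤ^k with b_1 + ⋯ + b_k = 0, b_i < 0 for all i ∈ T, and ∏_i c_i(b_i) ≠ 0 is finite, and Σ_{T ⊊ {1,…,k}} (−1)^{|T|} Σ_{(b_1,…,b_k) ∈ ℤ^k, Σ_i b_i = 0, b_i < 0 ∀ i ∈ T} ∏_{i=1}^{k} c_i(b_i) = ∏_{i=1}^{k} c_i(0). (This is the sign cancellation of polar contributions used in the proof of Theorem 2.8 to pass from the sum over tuples b with some negative entries to the product of z^0-coefficients of the I-functions.) -/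

import Mathlib

/-- The entries of an integer tuple summing to zero and bounded above by `B` are bounded below. -/
theorem neg_card_mul_le_of_sum_eq_zero {ι : Type*} [Fintype ι] {b : ι → ℤ} {B : ℤ} (hB : 0 ≤ B)
    (hsum : ∑ i, b i = 0) (hle : ∀ i, b i ≤ B) (i : ι) : -(Fintype.card ι * B) ≤ b i := by
  classical
  have h : ∑ j ∈ Finset.univ.erase i, b j ≤ ∑ _j : ι, B :=
    (Finset.sum_le_sum fun j _ => hle j).trans
      (Finset.sum_le_sum_of_subset_of_nonneg (Finset.erase_subset _ _) fun _ _ _ => hB)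
  rw [← Finset.add_sum_erase _ _ (Finset.mem_univ i)] at hsum
  simp only [Finset.sum_const, Finset.card_univ, nsmul_eq_mul] at h
  linarith

/-- The alternating sum over the sets of indices at which an integer tuple summing to zero is
negative detects the zero tuple. -/
theorem sum_neg_one_pow_card_of_sum_eq_zero {ι R : Type*} [Fintype ι] [DecidableEq ι] [CommRing R]
    {b : ι → ℤ} (hsum : ∑ i, b i = 0) :
    (∑ T : Finset ι, if ∀ i ∈ T, b i < 0 then (-1 : R) ^ T.card else 0) =
      if b = 0 then 1 else 0 := by
  have hpow : (Finset.univ.filter fun T : Finset ι => ∀ i ∈ T, b i < 0) =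
      (Finset.univ.filter fun i => b i < 0).powerset := by
    ext T
    simp [Finset.subset_iff]
  have hempty : (Finset.univ.filter fun i => b i < 0) = ∅ ↔ b = 0 := by
    simp only [Finset.filter_eq_empty_iff, Finset.mem_univ, true_implies, not_lt]
    refine ⟨fun h => ?_, fun h i => by simp [h]⟩
    funext i
    exact (Finset.sum_eq_zero_iff_of_nonneg fun i _ => @h i).1 hsum i (Finset.mem_univ i)
  rw [← Finset.sum_filter, hpow]
  have h := congrArg (Int.cast : ℤ → R)
    (Finset.sum_powerset_neg_one_pow_card (x := Finset.univ.filter fun i => b i < 0))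
  simp only [hempty] at h
  push_cast at h
  exact h

/-- **Sign cancellation of polar contributions** (used in the proof of Theorem 2.8 of
"Admissible covers and stable maps").

Let `R` be a commutative ring, `k ≥ 1`, and `c_1, …, c_k : ℤ → R` functions such that
`c_i(b) = 0` whenever `b > B`, for some integer `B ≥ 0`.  Then for every proper subset
`T ⊊ {1,…,k}` the set of tuples `b ∈ ℤ^k` with `Σ_i b_i = 0`, `b_i < 0` for all `i ∈ T`, and
`∏_i c_i(b_i) ≠ 0` is finite, and
`Σ_{T ⊊ {1,…,k}} (-1)^{|T|} Σ_{b : Σ b_i = 0, b_i < 0 ∀ i ∈ T} ∏_i c_i(b_i) = ∏_i c_i(0)`. -/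
theorem polar_sign_cancellation
    (R : Type*) [CommRing R] (k : ℕ) (hk : 1 ≤ k)
    (c : Fin k → ℤ → R) (B : ℤ) (hB : 0 ≤ B)
    (hbd : ∀ i b, B < b → c i b = 0) :
    (∀ T : Finset (Fin k), T ≠ Finset.univ →
      {b : Fin k → ℤ | (∑ i, b i) = 0 ∧ (∀ i ∈ T, b i < 0) ∧
        (∏ i, c i (b i)) ≠ 0}.Finite) ∧
    (∑ T ∈ Finset.univ.powerset.filter (· ≠ (Finset.univ : Finset (Fin k))),
        (-1 : R) ^ T.card *
          ∑ᶠ b : Fin k → ℤ,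
            if (∑ i, b i) = 0 ∧ (∀ i ∈ T, b i < 0) then ∏ i, c i (b i) else 0)
      = ∏ i, c i 0 := by
  classical
  set S : Finset (Fin k → ℤ) :=
    (Fintype.piFinset fun _ => Finset.Icc (-(k * B)) B).filter fun b => ∑ i, b i = 0 with hS
  have hmem : ∀ b : Fin k → ℤ, ∑ i, b i = 0 → ∏ i, c i (b i) ≠ 0 → b ∈ S := by
    intro b hsum hprod
    have hle : ∀ i, b i ≤ B := fun i => not_lt.1 fun hi =>
      hprod (Finset.prod_eq_zero (Finset.mem_univ i) (hbd i _ hi))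
    simp only [hS, Finset.mem_filter, Fintype.mem_piFinset, Finset.mem_Icc]
    refine ⟨fun i => ⟨?_, hle i⟩, hsum⟩
    simpa using neg_card_mul_le_of_sum_eq_zero hB hsum hle i
  have hzero : (0 : Fin k → ℤ) ∈ S := by
    have : 0 ≤ (k : ℤ) * B := by positivity
    simp [hS, hB, this]
  refine ⟨fun T _ => S.finite_toSet.subset fun b hb => hmem b hb.1 hb.2.2, ?_⟩
  have hfin : ∀ T : Finset (Fin k),
      (∑ᶠ b : Fin k → ℤ,
        if (∑ i, b i) = 0 ∧ (∀ i ∈ T, b i < 0) then ∏ i, c i (b i) else 0) =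
      ∑ b ∈ S, if ∀ i ∈ T, b i < 0 then ∏ i, c i (b i) else 0 := by
    intro T
    rw [finsum_eq_sum_of_support_subset (s := S)]
    · refine Finset.sum_congr rfl fun b hb => ?_
      have hsum : ∑ i, b i = 0 := (Finset.mem_filter.1 hb).2
      simp [hsum]
    · intro b hb
      obtain ⟨h, hprod⟩ := ite_ne_right_iff.1 (Function.mem_support.1 hb)
      exact hmem b h.1 hprod
  have huniv : ∀ b ∈ S, ¬ ∀ i ∈ (Finset.univ : Finset (Fin k)), b i < 0 := by
    intro b hb hneg
    have : Nonempty (Fin k) := ⟨⟨0, hk⟩⟩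
    exact (Finset.sum_neg hneg Finset.univ_nonempty).ne (Finset.mem_filter.1 hb).2
  simp only [hfin]
  rw [Finset.powerset_univ, Finset.sum_filter_of_ne]
  · simp only [Finset.mul_sum]
    rw [Finset.sum_comm]
    calc
      _ = ∑ b ∈ S, if b = 0 then ∏ i, c i (b i) else 0 := by
        refine Finset.sum_congr rfl fun b hb => ?_
        have h := sum_neg_one_pow_card_of_sum_eq_zero (R := R) (Finset.mem_filter.1 hb).2
        rw [← one_mul (∏ i, c i (b i)), ← zero_mul (∏ i, c i (b i)), ← ite_mul, ← h,
          Finset.sum_mul]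
        refine Finset.sum_congr rfl fun T _ => ?_
        split_ifs <;> simp
      _ = ∏ i, c i 0 := by simp [Finset.sum_ite_eq', hzero]
  · rintro T - hT rfl
    exact hT (by rw [Finset.sum_eq_zero fun b hb => if_neg (huniv b hb), mul_zero])
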